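/- arXiv:2311.17749 — 5 statements merged into one kernel-verified Lean document; each statement's English description precedes it below -/
import Mathlib

section
/- Let E = EuclideanSpace ℝ (Fin 14) and let the admissible control set be all of EuclideanSpace ℝ (Fin 7). Fix u_f ∈ EuclideanSpace ℝ (Fin 7), arbitrary functions a : E → EuclideanSpace ℝ (Fin 7) → EuclideanSpace ℝ (Fin 7) and f : E → EuclideanSpace ℝ (Fin 7) → E, and constants r_t > 0, r_u ≥ 0, r_a ≥ 0. Define the running cost L x u = r_t + r_u·‖u − u_f‖² + r_a·‖a x u‖². Then there is no function V : E → ℝ that is differentiable at x_f, satisfies V(x_f) = 0, is nonnegative on some neighborhood of x_f, and satisfies the stationary HJB equation at x_f with this L and f. -/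
open RealInnerProductSpace

/-- A function `V` satisfies the stationary HJB equation at `x`: `V` is differentiable
at `x` and `0` is the greatest lower bound of `{L x u + ⟪∇V(x), f x u⟫ : u ∈ 𝒰}`,
where here the admissible control set `𝒰` is all of `EuclideanSpace ℝ (Fin 7)`. -/
def SatisfiesHJBAt
    (f : EuclideanSpace ℝ (Fin 14) → EuclideanSpace ℝ (Fin 7) → EuclideanSpace ℝ (Fin 14))
    (L : EuclideanSpace ℝ (Fin 14) → EuclideanSpace ℝ (Fin 7) → ℝ)
    (V : EuclideanSpace ℝ (Fin 14) → ℝ) (x : EuclideanSpace ℝ (Fin 14)) : Prop :=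
  DifferentiableAt ℝ V x ∧
    IsGLB ((fun u => L x u + ⟪gradient V x, f x u⟫) '' Set.univ) 0

theorem stmt1
    (x_f : EuclideanSpace ℝ (Fin 14)) (u_f : EuclideanSpace ℝ (Fin 7))
    (a : EuclideanSpace ℝ (Fin 14) → EuclideanSpace ℝ (Fin 7) → EuclideanSpace ℝ (Fin 7))
    (f : EuclideanSpace ℝ (Fin 14) → EuclideanSpace ℝ (Fin 7) → EuclideanSpace ℝ (Fin 14))
    (r_t r_u r_a : ℝ) (hrt : 0 < r_t) (hru : 0 ≤ r_u) (hra : 0 ≤ r_a)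
    (L : EuclideanSpace ℝ (Fin 14) → EuclideanSpace ℝ (Fin 7) → ℝ)
    (hL : ∀ x u, L x u = r_t + r_u * ‖u - u_f‖ ^ 2 + r_a * ‖a x u‖ ^ 2) :
    ¬ ∃ V : EuclideanSpace ℝ (Fin 14) → ℝ,
        DifferentiableAt ℝ V x_f ∧ V x_f = 0 ∧
        (∀ᶠ x in nhds x_f, 0 ≤ V x) ∧
        SatisfiesHJBAt f L V x_f := by
  rintro ⟨V, -, hV0, hVnn, -, hGLB⟩
  have hmin : IsLocalMin V x_f := by
    filter_upwards [hVnn] with x hx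
    rwa [hV0]
  have hgrad : gradient V x_f = 0 := by
    simp [gradient, hmin.fderiv_eq_zero]
  have hle : r_t ≤ 0 := by
    refine hGLB.2 ?_
    rintro _ ⟨u, -, rfl⟩
    simp only [hgrad, inner_zero_left, add_zero, hL]
    have : 0 ≤ r_u * ‖u - u_f‖ ^ 2 := by positivity
    have : 0 ≤ r_a * ‖a x_f u‖ ^ 2 := by positivity
    linarith
  exact absurd hle hrt.not_ge
end

section
/- Let (T, x, u) be a feasible triple from x0 and let s ∈ [0, T]. Then the time-shifted triple (T − s, t ↦ x(t + s), t ↦ u(t + s)) is feasible from x(s) with horizon T − s, its cost equals ∫⁻_{[s,T]} L (x t) (u t) dt, and consequently V(x(s)) ≤ ∫⁻_{[s,T]} L (x t) (u t) dt. -/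
open MeasureTheory Set
open scoped ENNReal

/-- A triple `(T, x, u)` is feasible from `x0` with horizon `T`: `T ≥ 0`, `x 0 = x0`,
`x T = xf`, and for every `t ∈ [0, T]` the state `x` has derivative `f (x t) (u t)`
at `t` within `[0, T]`. -/
def Feasible {n m : ℕ} (f : (Fin n → ℝ) → (Fin m → ℝ) → (Fin n → ℝ))
    (xf x0 : Fin n → ℝ) (T : ℝ) (x : ℝ → Fin n → ℝ) (u : ℝ → Fin m → ℝ) : Prop :=
  0 ≤ T ∧ x 0 = x0 ∧ x T = xf ∧
    ∀ t ∈ Icc (0 : ℝ) T, HasDerivWithinAt x (f (x t) (u t)) (Icc (0 : ℝ) T) t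

/-- The cost of a triple `(T, x, u)`: the Lebesgue integral `∫⁻_{[0,T]} L (x t) (u t) dt`. -/
noncomputable def cost {n m : ℕ} (L : (Fin n → ℝ) → (Fin m → ℝ) → ℝ≥0∞) (T : ℝ)
    (x : ℝ → Fin n → ℝ) (u : ℝ → Fin m → ℝ) : ℝ≥0∞ :=
  ∫⁻ t in Icc (0 : ℝ) T, L (x t) (u t)

/-- The free terminal time value `V(x0)`: infimum of the cost over all feasible triples
from `x0` (in `ℝ≥0∞`; equal to `⊤` if no feasible triple exists). -/
noncomputable def freeValue {n m : ℕ} (f : (Fin n → ℝ) → (Fin m → ℝ) → (Fin n → ℝ))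
    (L : (Fin n → ℝ) → (Fin m → ℝ) → ℝ≥0∞) (xf x0 : Fin n → ℝ) : ℝ≥0∞ :=
  ⨅ (T : ℝ) (x : ℝ → Fin n → ℝ) (u : ℝ → Fin m → ℝ) (_ : Feasible f xf x0 T x u),
    cost L T x u

/-- The fixed terminal time value `V_fix(x0, T)`: infimum of the cost over all pairs
`(x, u)` such that `(T, x, u)` is feasible from `x0`. -/
noncomputable def fixValue {n m : ℕ} (f : (Fin n → ℝ) → (Fin m → ℝ) → (Fin n → ℝ))
    (L : (Fin n → ℝ) → (Fin m → ℝ) → ℝ≥0∞) (xf x0 : Fin n → ℝ) (T : ℝ) : ℝ≥0∞ :=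
  ⨅ (x : ℝ → Fin n → ℝ) (u : ℝ → Fin m → ℝ) (_ : Feasible f xf x0 T x u),
    cost L T x u

/-- Shifting time by `s` turns a feasible triple into one that starts at `x s`. -/
theorem Feasible.shift {n m : ℕ} {f : (Fin n → ℝ) → (Fin m → ℝ) → (Fin n → ℝ)}
    {xf x0 : Fin n → ℝ} {T : ℝ} {x : ℝ → Fin n → ℝ} {u : ℝ → Fin m → ℝ}
    (hfeas : Feasible f xf x0 T x u) {s : ℝ} (hs : s ∈ Icc (0 : ℝ) T) :
    Feasible f xf (x s) (T - s) (fun t => x (t + s)) (fun t => u (t + s)) := by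
  obtain ⟨-, -, hxT, hderiv⟩ := hfeas
  refine ⟨sub_nonneg.2 hs.2, by simp, by simpa using hxT, fun t ht => ?_⟩
  have hmaps : MapsTo (fun r : ℝ => r + s) (Icc 0 (T - s)) (Icc 0 T) := fun r hr =>
    ⟨add_nonneg hr.1 hs.1, le_sub_iff_add_le.1 hr.2⟩
  have hshift : HasDerivWithinAt (fun r : ℝ => r + s) 1 (Icc 0 (T - s)) t :=
    (hasDerivWithinAt_id t _).add_const s
  simpa [Function.comp_def] using
    HasDerivWithinAt.scomp t (hderiv (t + s) (hmaps ht)) hshift hmaps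

/-- The cost of a time-shifted triple is the cost accumulated on `[s, T]`. -/
theorem cost_shift {n m : ℕ} (L : (Fin n → ℝ) → (Fin m → ℝ) → ℝ≥0∞) (T s : ℝ)
    (x : ℝ → Fin n → ℝ) (u : ℝ → Fin m → ℝ) :
    cost L (T - s) (fun t => x (t + s)) (fun t => u (t + s)) =
      ∫⁻ t in Icc s T, L (x t) (u t) := by
  have h := (measurePreserving_add_right (volume : Measure ℝ) s).setLIntegral_comp_preimage_emb
    (measurableEmbedding_addRight s) (fun t => L (x t) (u t)) (Icc s T)
  simpa [cost] using h

/-- The free terminal time value is at most the cost of any feasible triple. -/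
theorem Feasible.freeValue_le_cost {n m : ℕ} {f : (Fin n → ℝ) → (Fin m → ℝ) → (Fin n → ℝ)}
    {xf x0 : Fin n → ℝ} {T : ℝ} {x : ℝ → Fin n → ℝ} {u : ℝ → Fin m → ℝ}
    (hfeas : Feasible f xf x0 T x u) (L : (Fin n → ℝ) → (Fin m → ℝ) → ℝ≥0∞) :
    freeValue f L xf x0 ≤ cost L T x u :=
  iInf_le_of_le T <| iInf_le_of_le x <| iInf_le_of_le u <| iInf_le _ hfeas

theorem stmt5 {n m : ℕ} (f : (Fin n → ℝ) → (Fin m → ℝ) → (Fin n → ℝ))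
    (L : (Fin n → ℝ) → (Fin m → ℝ) → ℝ≥0∞) (xf x0 : Fin n → ℝ)
    (T : ℝ) (x : ℝ → Fin n → ℝ) (u : ℝ → Fin m → ℝ)
    (hfeas : Feasible f xf x0 T x u) (s : ℝ) (hs : s ∈ Icc (0 : ℝ) T) :
    Feasible f xf (x s) (T - s) (fun t => x (t + s)) (fun t => u (t + s)) ∧
      cost L (T - s) (fun t => x (t + s)) (fun t => u (t + s)) =
        ∫⁻ t in Icc s T, L (x t) (u t) ∧
      freeValue f L xf (x s) ≤ ∫⁻ t in Icc s T, L (x t) (u t) := by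
  have hshift := hfeas.shift hs
  have hcost := cost_shift L T s x u
  exact ⟨hshift, hcost, hcost ▸ hshift.freeValue_le_cost L⟩
end

section
/- The saturating function has unit slope at the reference point: σ is differentiable at u1 and deriv σ u1 = 1. -/
theorem stmt12 (u_min u1 u_max c1 c2 : ℝ)
    (h1 : u_min < u1) (h2 : u1 < u_max)
    (hc1 : c1 = (u_max - u1) / (u1 - u_min))
    (hc2 : c2 = (u_max - u_min) / ((u_max - u1) * (u1 - u_min)))
    (σ : ℝ → ℝ)
    (hσ : ∀ u, σ u = u_min + (u_max - u_min) / (1 + c1 * Real.exp (-c2 * (u - u1)))) :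
    DifferentiableAt ℝ σ u1 ∧ deriv σ u1 = 1 := by
  suffices h : HasDerivAt σ 1 u1 from ⟨h.differentiableAt, h.deriv⟩
  have ha : u1 - u_min ≠ 0 := (sub_pos.2 h1).ne'
  have hb : u_max - u1 ≠ 0 := (sub_pos.2 h2).ne'
  have hd : u_max - u_min ≠ 0 := (sub_pos.2 (h1.trans h2)).ne'
  have hsum : 1 + c1 = (u_max - u_min) / (u1 - u_min) := by
    rw [hc1]; field_simp; ring
  have hprod : c1 * c2 = (u_max - u_min) / (u1 - u_min) ^ 2 := by
    rw [hc1, hc2]; field_simp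
  have hden : HasDerivAt (fun u => 1 + c1 * Real.exp (-c2 * (u - u1))) (-(c1 * c2)) u1 := by
    have h := (((((hasDerivAt_id u1).sub_const u1).const_mul (-c2)).exp).const_mul c1).const_add 1
    exact h.congr_deriv (by simp)
  have hne : 1 + c1 * Real.exp (-c2 * (u1 - u1)) ≠ 0 := by
    simpa [hsum] using ⟨hd, ha⟩
  rw [funext hσ]
  refine (((hasDerivAt_const u1 (u_max - u_min)).fun_div hden hne).const_add u_min).congr_deriv ?_
  simp only [sub_self, mul_zero, Real.exp_zero, mul_one, hsum, hprod]
  field_simp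
  ring
end

section
/- LQR verification inequality (completion of squares): for every continuous control u : ℝ → (Fin m → ℝ) and every state trajectory x : ℝ → (Fin n → ℝ) with x 0 = x0 and HasDerivAt x (A.mulVec (x t) + B.mulVec (u t)) t for all t ∈ [0, T], the quadratic cost ∫_0^T (⟪x t, Q.mulVec (x t)⟫ + ⟪u t, R.mulVec (u t)⟫) dt + ⟪x T, Qf.mulVec (x T)⟫ is at least ⟪x0, (P 0).mulVec x0⟫. -/
open Matrix MeasureTheory Set

attribute [local instance] Matrix.normedAddCommGroup Matrix.normedSpace

/-- Product rule for the time-dependent bilinear form `v ⬝ᵥ M *ᵥ w`. -/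
theorem hasDerivAt_dotProduct_mulVec {k l : ℕ} {M : ℝ → Matrix (Fin k) (Fin l) ℝ}
    {M' : Matrix (Fin k) (Fin l) ℝ} {v : ℝ → Fin k → ℝ} {v' : Fin k → ℝ}
    {w : ℝ → Fin l → ℝ} {w' : Fin l → ℝ} {t : ℝ}
    (hM : HasDerivAt M M' t) (hv : HasDerivAt v v' t) (hw : HasDerivAt w w' t) :
    HasDerivAt (fun s => v s ⬝ᵥ M s *ᵥ w s)
      (v' ⬝ᵥ M t *ᵥ w t + v t ⬝ᵥ (M' *ᵥ w t + M t *ᵥ w')) t := by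
  have hMentry : ∀ i j, HasDerivAt (fun s => M s i j) (M' i j) t := fun i j =>
    hasDerivAt_pi.1 (hasDerivAt_pi.1 hM i) j
  have hventry := hasDerivAt_pi.1 hv
  have hwentry := hasDerivAt_pi.1 hw
  have hrow : ∀ i, HasDerivAt (fun s => (M s *ᵥ w s) i) ((M' *ᵥ w t + M t *ᵥ w') i) t := by
    intro i
    have h := HasDerivAt.fun_sum (u := Finset.univ)
      fun j _ => (hMentry i j).fun_mul (hwentry j)
    simpa only [mulVec, dotProduct, Pi.add_apply, Finset.sum_add_distrib] using h
  have h := HasDerivAt.fun_sum (u := Finset.univ)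
    fun i _ => (hventry i).fun_mul (hrow i)
  simpa only [dotProduct, Finset.sum_add_distrib] using h

/-- Completion of squares for a positive definite quadratic form. -/
theorem Matrix.PosDef.completion_of_squares_nonneg {k : ℕ} {R : Matrix (Fin k) (Fin k) ℝ}
    (hR : R.PosDef) (u y : Fin k → ℝ) :
    0 ≤ u ⬝ᵥ R *ᵥ u + 2 * (u ⬝ᵥ y) + y ⬝ᵥ R⁻¹ *ᵥ y := by
  have hinv : R *ᵥ (R⁻¹ *ᵥ y) = y := by
    rw [mulVec_mulVec, mul_nonsing_inv _ ((isUnit_iff_isUnit_det R).1 hR.isUnit), one_mulVec]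
  have hsymm : Rᵀ = R := hR.isHermitian
  have hcross : (R⁻¹ *ᵥ y) ⬝ᵥ R *ᵥ u = u ⬝ᵥ y := by
    rw [dotProduct_mulVec, ← mulVec_transpose, hsymm, hinv, dotProduct_comm]
  have h := hR.posSemidef.dotProduct_mulVec_nonneg (u + R⁻¹ *ᵥ y)
  rw [star_trivial, mulVec_add, hinv, add_dotProduct, dotProduct_add, dotProduct_add, hcross,
    dotProduct_comm (R⁻¹ *ᵥ y) y] at h
  linarith

/-- Along a controlled trajectory, the Riccati value function decreases at most at the rate of
the running cost. -/
theorem neg_riccati_value_deriv_le {n m : ℕ} {A P Q : Matrix (Fin n) (Fin n) ℝ}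
    {B : Matrix (Fin n) (Fin m) ℝ} {R : Matrix (Fin m) (Fin m) ℝ}
    (hR : R.PosDef) (hP : P.IsSymm) (x : Fin n → ℝ) (u : Fin m → ℝ) :
    -((A *ᵥ x + B *ᵥ u) ⬝ᵥ P *ᵥ x +
      x ⬝ᵥ (-(Aᵀ * P + P * A - P * B * R⁻¹ * Bᵀ * P + Q) *ᵥ x +
        P *ᵥ (A *ᵥ x + B *ᵥ u))) ≤
      x ⬝ᵥ Q *ᵥ x + u ⬝ᵥ R *ᵥ u := by
  have htranspose : ∀ {k l : ℕ} (M : Matrix (Fin k) (Fin l) ℝ) (v : Fin l → ℝ)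
      (w : Fin k → ℝ), w ⬝ᵥ M *ᵥ v = v ⬝ᵥ Mᵀ *ᵥ w := fun M v w => by
    rw [dotProduct_mulVec, ← mulVec_transpose, dotProduct_comm]
  have hstate : x ⬝ᵥ Aᵀ *ᵥ (P *ᵥ x) = (A *ᵥ x) ⬝ᵥ P *ᵥ x := by
    rw [dotProduct_comm (A *ᵥ x), htranspose A]
  have hcontrol : (B *ᵥ u) ⬝ᵥ P *ᵥ x = u ⬝ᵥ Bᵀ *ᵥ (P *ᵥ x) := by
    rw [dotProduct_comm, htranspose]
  have hcontrol' : x ⬝ᵥ P *ᵥ (B *ᵥ u) = u ⬝ᵥ Bᵀ *ᵥ (P *ᵥ x) := by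
    rw [htranspose P, hP.eq, hcontrol]
  have hgain : x ⬝ᵥ P *ᵥ (B *ᵥ (R⁻¹ *ᵥ (Bᵀ *ᵥ (P *ᵥ x)))) =
      (Bᵀ *ᵥ (P *ᵥ x)) ⬝ᵥ R⁻¹ *ᵥ (Bᵀ *ᵥ (P *ᵥ x)) := by
    rw [htranspose P, hP.eq, dotProduct_comm, htranspose B, dotProduct_comm]
  have hsquare := hR.completion_of_squares_nonneg u (Bᵀ *ᵥ (P *ᵥ x))
  simp only [neg_mulVec, add_mulVec, sub_mulVec, ← mulVec_mulVec, mulVec_add, add_dotProduct,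
    dotProduct_add, dotProduct_sub, dotProduct_neg, hstate, hcontrol, hcontrol', hgain]
  linarith

theorem stmt14 {n m : ℕ}
    (A : Matrix (Fin n) (Fin n) ℝ) (B : Matrix (Fin n) (Fin m) ℝ)
    (Q Qf : Matrix (Fin n) (Fin n) ℝ) (R : Matrix (Fin m) (Fin m) ℝ)
    (hQ : Q.PosSemidef) (hQf : Qf.PosSemidef) (hR : R.PosDef)
    (T : ℝ) (hT : 0 ≤ T) (x0 : Fin n → ℝ)
    (P : ℝ → Matrix (Fin n) (Fin n) ℝ)
    (hPsymm : ∀ t ∈ Icc (0 : ℝ) T, (P t).IsSymm)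
    (hRiccati : ∀ t ∈ Icc (0 : ℝ) T,
      HasDerivAt P (-(Aᵀ * P t + P t * A - P t * B * R⁻¹ * Bᵀ * P t + Q)) t)
    (hPT : P T = Qf)
    (u : ℝ → Fin m → ℝ) (hu : Continuous u)
    (x : ℝ → Fin n → ℝ) (hx0 : x 0 = x0)
    (hode : ∀ t ∈ Icc (0 : ℝ) T,
      HasDerivAt x (A.mulVec (x t) + B.mulVec (u t)) t) :
    x0 ⬝ᵥ (P 0).mulVec x0 ≤
      (∫ t in (0 : ℝ)..T, (x t ⬝ᵥ Q.mulVec (x t) + u t ⬝ᵥ R.mulVec (u t))) +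
        x T ⬝ᵥ Qf.mulVec (x T) := by
  have hxcont : ContinuousOn x (Icc 0 T) := fun t ht =>
    (hode t ht).continuousAt.continuousWithinAt
  have hquad : ∀ {k : ℕ} (M : Matrix (Fin k) (Fin k) ℝ),
      Continuous fun v : Fin k → ℝ => v ⬝ᵥ M *ᵥ v := fun M =>
    continuous_id.dotProduct (continuous_const.matrix_mulVec continuous_id)
  have hcost : ContinuousOn (fun t => x t ⬝ᵥ Q *ᵥ x t + u t ⬝ᵥ R *ᵥ u t) (Icc 0 T) :=
    ((hquad Q).comp_continuousOn hxcont).add ((hquad R).comp hu).continuousOn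
  have hderiv : ∀ t ∈ Icc (0 : ℝ) T, HasDerivAt (fun s => -(x s ⬝ᵥ P s *ᵥ x s)) _ t :=
    fun t ht => (hasDerivAt_dotProduct_mulVec (hRiccati t ht) (hode t ht) (hode t ht)).fun_neg
  have h := intervalIntegral.sub_le_integral_of_hasDeriv_right_of_le hT
    (fun t ht => (hderiv t ht).continuousAt.continuousWithinAt)
    (fun t ht => (hderiv t (Ioo_subset_Icc_self ht)).hasDerivWithinAt)
    (hcost.integrableOn_Icc)
    (fun t ht => neg_riccati_value_deriv_le hR (hPsymm t (Ioo_subset_Icc_self ht)) (x t) (u t))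
  rw [hPT, hx0] at h
  linarith
end

section
/- LQR feedback optimality: suppose x : ℝ → (Fin n → ℝ) satisfies x 0 = x0 and the closed-loop equation HasDerivAt x ((A − B * R⁻¹ * Bᵀ * P t).mulVec (x t)) t for all t ∈ [0, T], and define the feedback control u t = −(R⁻¹ * Bᵀ * P t).mulVec (x t). Then the quadratic cost ∫_0^T (⟪x t, Q.mulVec (x t)⟫ + ⟪u t, R.mulVec (u t)⟫) dt + ⟪x T, Qf.mulVec (x T)⟫ equals ⟪x0, (P 0).mulVec x0⟫; in particular the linear feedback u achieves the optimal value x0ᵀ P(0) x0 of the linear quadratic problem. -/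
open Matrix MeasureTheory Set

attribute [local instance] Matrix.normedAddCommGroup Matrix.normedSpace

/-- Product rule for the quadratic form `x ⬝ᵥ P *ᵥ x` along differentiable curves. -/
theorem hasDerivAt_dotProduct_mulVec_s15 {n : ℕ} {P : ℝ → Matrix (Fin n) (Fin n) ℝ}
    {dP : Matrix (Fin n) (Fin n) ℝ} {x : ℝ → Fin n → ℝ} {dx : Fin n → ℝ} {t : ℝ}
    (hP : HasDerivAt P dP t) (hx : HasDerivAt x dx t) :
    HasDerivAt (fun s => x s ⬝ᵥ P s *ᵥ x s)
      (dx ⬝ᵥ P t *ᵥ x t + x t ⬝ᵥ (dP *ᵥ x t + P t *ᵥ dx)) t := by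
  have hx_coord : ∀ i, HasDerivAt (fun s => x s i) (dx i) t := hasDerivAt_pi.1 hx
  have hP_coord : ∀ i j, HasDerivAt (fun s => P s i j) (dP i j) t := fun i =>
    hasDerivAt_pi.1 (hasDerivAt_pi.1 hP i)
  have h_sum := HasDerivAt.fun_sum (u := Finset.univ) fun i _ =>
    (hx_coord i).fun_mul (HasDerivAt.fun_sum (u := Finset.univ) fun j _ =>
      (hP_coord i j).fun_mul (hx_coord j))
  refine h_sum.congr_deriv ?_
  simp only [dotProduct, mulVec, Pi.add_apply, Finset.sum_add_distrib]

/-- The control cost of the feedback `u = -R⁻¹ Bᵀ P x`, as a quadratic form in the state. -/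
theorem feedback_dotProduct_mulVec {n m : ℕ} {B : Matrix (Fin n) (Fin m) ℝ}
    {R : Matrix (Fin m) (Fin m) ℝ} (hR : R.PosDef) {P : Matrix (Fin n) (Fin n) ℝ}
    (hP : P.IsSymm) (x : Fin n → ℝ) :
    (-(R⁻¹ * Bᵀ * P) *ᵥ x) ⬝ᵥ R *ᵥ (-(R⁻¹ * Bᵀ * P) *ᵥ x) =
      x ⬝ᵥ (P * B * R⁻¹ * Bᵀ * P) *ᵥ x := by
  have hR_symm : Rᵀ = R := by simpa using hR.isHermitian.eq
  have hR_unit : IsUnit R.det := (Matrix.isUnit_iff_isUnit_det R).1 hR.isUnit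
  rw [dotProduct_comm, mulVec_mulVec, dotProduct_mulVec, ← mulVec_transpose, mulVec_mulVec,
    dotProduct_comm]
  congr 2
  simp only [transpose_neg, transpose_mul, transpose_transpose, transpose_nonsing_inv, hR_symm,
    hP.eq, Matrix.neg_mul, Matrix.mul_neg, neg_neg, Matrix.mul_assoc,
    Matrix.mul_nonsing_inv_cancel_left _ _ hR_unit]

/-- Completion of squares: along the closed loop, the Riccati equation makes the derivative of
`x ⬝ᵥ P *ᵥ x` equal to minus the running cost. -/
theorem closedLoop_deriv_eq_neg_cost {n m : ℕ} (A : Matrix (Fin n) (Fin n) ℝ)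
    (B : Matrix (Fin n) (Fin m) ℝ) (Q : Matrix (Fin n) (Fin n) ℝ)
    {R : Matrix (Fin m) (Fin m) ℝ} (hR : R.PosDef) {P : Matrix (Fin n) (Fin n) ℝ}
    (hP : P.IsSymm) (x : Fin n → ℝ) :
    ((A - B * R⁻¹ * Bᵀ * P) *ᵥ x) ⬝ᵥ P *ᵥ x +
        x ⬝ᵥ (-(Aᵀ * P + P * A - P * B * R⁻¹ * Bᵀ * P + Q) *ᵥ x +
          P *ᵥ (A - B * R⁻¹ * Bᵀ * P) *ᵥ x) =
      -(x ⬝ᵥ Q *ᵥ x + (-(R⁻¹ * Bᵀ * P) *ᵥ x) ⬝ᵥ R *ᵥ (-(R⁻¹ * Bᵀ * P) *ᵥ x)) := by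
  have hR_symm : Rᵀ = R := by simpa using hR.isHermitian.eq
  rw [feedback_dotProduct_mulVec hR hP, dotProduct_comm, dotProduct_mulVec, ← mulVec_transpose,
    dotProduct_comm _ x, mulVec_mulVec, mulVec_mulVec, ← dotProduct_add, ← dotProduct_add,
    ← dotProduct_neg, ← add_mulVec, ← add_mulVec, ← add_mulVec, ← neg_mulVec]
  congr 2
  simp only [transpose_sub, transpose_mul, transpose_transpose, transpose_nonsing_inv, hR_symm,
    hP.eq, Matrix.sub_mul, Matrix.mul_sub, Matrix.mul_assoc]
  abel

theorem stmt15 {n m : ℕ}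
    (A : Matrix (Fin n) (Fin n) ℝ) (B : Matrix (Fin n) (Fin m) ℝ)
    (Q Qf : Matrix (Fin n) (Fin n) ℝ) (R : Matrix (Fin m) (Fin m) ℝ)
    (hQ : Q.PosSemidef) (hQf : Qf.PosSemidef) (hR : R.PosDef)
    (T : ℝ) (hT : 0 ≤ T) (x0 : Fin n → ℝ)
    (P : ℝ → Matrix (Fin n) (Fin n) ℝ)
    (hPsymm : ∀ t ∈ Icc (0 : ℝ) T, (P t).IsSymm)
    (hRiccati : ∀ t ∈ Icc (0 : ℝ) T,
      HasDerivAt P (-(Aᵀ * P t + P t * A - P t * B * R⁻¹ * Bᵀ * P t + Q)) t)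
    (hPT : P T = Qf)
    (x : ℝ → Fin n → ℝ) (hx0 : x 0 = x0)
    (hode : ∀ t ∈ Icc (0 : ℝ) T,
      HasDerivAt x ((A - B * R⁻¹ * Bᵀ * P t).mulVec (x t)) t)
    (u : ℝ → Fin m → ℝ)
    (hu : ∀ t, u t = -(R⁻¹ * Bᵀ * P t).mulVec (x t)) :
    (∫ t in (0 : ℝ)..T, (x t ⬝ᵥ Q.mulVec (x t) + u t ⬝ᵥ R.mulVec (u t))) +
        x T ⬝ᵥ Qf.mulVec (x T) =
      x0 ⬝ᵥ (P 0).mulVec x0 := by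
  have hderiv : ∀ t ∈ uIcc (0 : ℝ) T, HasDerivAt (fun s => x s ⬝ᵥ P s *ᵥ x s)
      (-(x t ⬝ᵥ Q *ᵥ x t + u t ⬝ᵥ R *ᵥ u t)) t := by
    intro t ht
    rw [uIcc_of_le hT] at ht
    refine (hasDerivAt_dotProduct_mulVec_s15 (hRiccati t ht) (hode t ht)).congr_deriv ?_
    rw [hu t, ← neg_mulVec]
    exact closedLoop_deriv_eq_neg_cost A B Q hR (hPsymm t ht) (x t)
  have hx_cont : ContinuousOn x (uIcc 0 T) := fun t ht =>
    (hode t (uIcc_of_le hT ▸ ht)).continuousAt.continuousWithinAt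
  have hP_cont : ContinuousOn P (uIcc 0 T) := fun t ht =>
    (hRiccati t (uIcc_of_le hT ▸ ht)).continuousAt.continuousWithinAt
  have hu_cont : ContinuousOn u (uIcc 0 T) := by
    rw [funext hu]
    rw [continuousOn_iff_continuous_domRestrict] at *
    exact ((continuous_const.matrix_mul hP_cont).matrix_mulVec hx_cont).neg
  have hcost_cont :
      ContinuousOn (fun t => x t ⬝ᵥ Q *ᵥ x t + u t ⬝ᵥ R *ᵥ u t) (uIcc 0 T) := by
    rw [continuousOn_iff_continuous_domRestrict] at *
    exact (hx_cont.dotProduct (continuous_const.matrix_mulVec hx_cont)).add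
      (hu_cont.dotProduct (continuous_const.matrix_mulVec hu_cont))
  have hFTC := intervalIntegral.integral_eq_sub_of_hasDerivAt hderiv
    hcost_cont.neg.intervalIntegrable
  rw [intervalIntegral.integral_neg, hPT, hx0] at hFTC
  linarith
end
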